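/- Let (ε_1, …, ε_n) be an orthonormal basis of V, let μ_1, …, μ_n be real numbers with 0 < μ_i ≤ 1, and let L = Σ_{i=1}^n μ_i ℓ(ε_i) r(ε_i) as an endomorphism of Λ•V with the induced inner product. Then the operator norm of L equals Σ_{i=1}^n μ_i; in particular ‖Lψ‖ ≤ n‖ψ‖ for every ψ ∈ Λ•V, and the operator norm of L equals n if and only if μ_i = 1 for all i. -/

import Mathlib

open ExteriorAlgebra

variable {V : Type*} [NormedAddCommGroup V] [InnerProductSpace ℝ V] [FiniteDimensional ℝ V]

/-- The interior product `ι_v` on the exterior algebra of a real inner product space: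
the unique antiderivation extending `w ↦ ⟪v, w⟫`. -/
noncomputable def interiorProduct (v : V) : Module.End ℝ (ExteriorAlgebra ℝ V) :=
  CliffordAlgebra.contractLeft (Q := (0 : QuadraticForm ℝ V)) (innerₗ V v)

/-- The left Clifford action `ℓ(v) ω = v ∧ ω − ι_v ω`. -/
noncomputable def leftAction (v : V) : Module.End ℝ (ExteriorAlgebra ℝ V) :=
  LinearMap.mulLeft ℝ (ι ℝ v) - interiorProduct v

/-- The right Clifford action, `r(v) ω = (−1)^p (v ∧ ω + ι_v ω)` on `p`-forms.
(`CliffordAlgebra.involute` is multiplication by `(−1)^p` on `p`-forms.) -/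
noncomputable def rightAction (v : V) : Module.End ℝ (ExteriorAlgebra ℝ V) :=
  (LinearMap.mulLeft ℝ (ι ℝ v) + interiorProduct v) ∘ₗ
    (CliffordAlgebra.involute (Q := (0 : QuadraticForm ℝ V))).toLinearMap

/-- The monomial `ε_{i₁} ∧ ⋯ ∧ ε_{i_p}` associated with a family `ε` and a finite set of
indices `s = {i₁ < ⋯ < i_p}` (taken in increasing order; `s = ∅` gives `1`). -/
noncomputable def monomial {n : ℕ} (ε : Fin n → V) (s : Finset (Fin n)) :
    ExteriorAlgebra ℝ V :=
  ((s.sort (· ≤ ·)).map (fun i => ι ℝ (ε i))).prod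

/-- `B` is the inner product on `Λ•V` induced by the inner product of `V`: it is the
symmetric bilinear form for which, given any orthonormal basis `(ε i)` of `V`, the
monomials `ε_{i₁} ∧ ⋯ ∧ ε_{i_p}` with `i₁ < ⋯ < i_p` (together with `1`) form an
orthonormal basis. -/
def IsInducedInner (B : LinearMap.BilinForm ℝ (ExteriorAlgebra ℝ V)) : Prop :=
  (∀ ω η, B ω η = B η ω) ∧
  ∀ (ε : OrthonormalBasis (Fin (Module.finrank ℝ V)) ℝ V)
    (s t : Finset (Fin (Module.finrank ℝ V))),
    B (monomial (⇑ε) s) (monomial (⇑ε) t) = if s = t then 1 else 0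

section MonomialEigenvectors

variable {E : Type*} [NormedAddCommGroup E] [InnerProductSpace ℝ E]

lemma ι_mul_ι_mul_comm (v w : E) (x : ExteriorAlgebra ℝ E) :
    ι ℝ v * (ι ℝ w * x) = -(ι ℝ w * (ι ℝ v * x)) := by
  have h : ι ℝ v * ι ℝ w + ι ℝ w * ι ℝ v = 0 := ι_add_mul_swap v w
  rw [← mul_assoc, ← mul_assoc, eq_neg_of_add_eq_zero_left h, neg_mul]

lemma ι_mul_prod_eq_zero {κ : Type*} (f : κ → E) (i : κ) (l : List κ) (hi : i ∈ l) :
    ι ℝ (f i) * (l.map fun j => ι ℝ (f j)).prod = 0 := by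
  induction l with
  | nil => simp at hi
  | cons j l ih =>
    rw [List.map_cons, List.prod_cons]
    rcases List.mem_cons.1 hi with rfl | h
    · rw [← mul_assoc, ι_sq_zero, zero_mul]
    · rw [ι_mul_ι_mul_comm, ih h, mul_zero, neg_zero]

lemma interiorProduct_ι_mul (v w : E) (x : ExteriorAlgebra ℝ E) :
    interiorProduct v (ι ℝ w * x) = inner ℝ v w • x - ι ℝ w * interiorProduct v x :=
  CliffordAlgebra.contractLeft_ι_mul _ _ _

lemma interiorProduct_prod_eq_zero {κ : Type*} (f : κ → E) (v : E) (l : List κ)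
    (hv : ∀ j ∈ l, inner ℝ v (f j) = 0) :
    interiorProduct v (l.map fun j => ι ℝ (f j)).prod = 0 := by
  induction l with
  | nil => exact CliffordAlgebra.contractLeft_one (Q := (0 : QuadraticForm ℝ E)) _
  | cons j l ih =>
    rw [List.map_cons, List.prod_cons, interiorProduct_ι_mul, hv j (by simp),
      ih fun k hk => hv k (by simp [hk]), zero_smul, mul_zero, sub_zero]

lemma prod_ι_eq_or_eq_neg_of_perm {κ : Type*} (f : κ → E) {l l' : List κ} (h : l.Perm l') :
    (l.map fun j => ι ℝ (f j)).prod = (l'.map fun j => ι ℝ (f j)).prod ∨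
      (l.map fun j => ι ℝ (f j)).prod = -(l'.map fun j => ι ℝ (f j)).prod := by
  induction h with
  | nil => exact Or.inl rfl
  | cons j _ ih =>
    simp only [List.map_cons, List.prod_cons]
    rcases ih with h | h <;> simp [h]
  | swap j k l =>
    simp only [List.map_cons, List.prod_cons]
    exact Or.inr (ι_mul_ι_mul_comm _ _ _)
  | trans _ _ ih₁ ih₂ =>
    rcases ih₁ with h₁ | h₁ <;> rcases ih₂ with h₂ | h₂ <;> simp [h₁, h₂]

lemma prod_ι_mem_span_monomial {n : ℕ} (f : Fin n → E) (l : List (Fin n)) (hl : l.Nodup) :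
    (l.map fun j => ι ℝ (f j)).prod ∈ Submodule.span ℝ (Set.range (monomial f)) := by
  have hmem : monomial f l.toFinset ∈ Submodule.span ℝ (Set.range (monomial f)) :=
    Submodule.subset_span ⟨_, rfl⟩
  have hperm : l.Perm (l.toFinset.sort (· ≤ ·)) := by
    rw [List.perm_ext_iff_of_nodup hl (Finset.sort_nodup _ _)]
    simp
  rcases prod_ι_eq_or_eq_neg_of_perm f hperm with h | h
  · rw [h]; exact hmem
  · rw [h]; exact neg_mem hmem

lemma span_monomial_eq_top {n : ℕ} (b : Module.Basis (Fin n) ℝ E) :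
    Submodule.span ℝ (Set.range (monomial b)) = ⊤ := by
  have hι : ∀ i x, x ∈ Submodule.span ℝ (Set.range (monomial b)) →
      ι ℝ (b i) * x ∈ Submodule.span ℝ (Set.range (monomial b)) := by
    intro i x hx
    induction hx using Submodule.span_induction with
    | mem x hx =>
      obtain ⟨s, rfl⟩ := hx
      by_cases hi : i ∈ s
      · rw [monomial, ι_mul_prod_eq_zero _ _ _ (by simpa using hi)]
        exact zero_mem _
      · have := prod_ι_mem_span_monomial b (i :: s.sort (· ≤ ·))
          (List.nodup_cons.2 ⟨by simpa using hi, Finset.sort_nodup _ _⟩)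
        rwa [List.map_cons, List.prod_cons] at this
    | zero => simp
    | add x y _ _ hx hy => rw [mul_add]; exact add_mem hx hy
    | smul c x _ hx => rw [mul_smul_comm]; exact Submodule.smul_mem _ _ hx
  refine eq_top_iff.2 fun x _ => ?_
  induction x using CliffordAlgebra.left_induction with
  | algebraMap r =>
    rw [Algebra.algebraMap_eq_smul_one]
    exact Submodule.smul_mem _ _ (prod_ι_mem_span_monomial b [] List.nodup_nil)
  | add x y hx hy => exact add_mem (hx trivial) (hy trivial)
  | ι_mul x v hx =>
    change ι ℝ v * x ∈ Submodule.span ℝ (Set.range (monomial b))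
    rw [← b.sum_repr v, map_sum, Finset.sum_mul]
    refine sum_mem fun i _ => ?_
    rw [map_smul, smul_mul_assoc]
    exact Submodule.smul_mem _ _ (hι i x (hx trivial))

lemma leftAction_mul_rightAction_monomial {n : ℕ} (ε : OrthonormalBasis (Fin n) ℝ E)
    (i : Fin n) (s : Finset (Fin n)) :
    (leftAction (ε i) * rightAction (ε i)) (monomial ε s) =
      ((-1 : ℝ) ^ s.card * if i ∈ s then 1 else -1) • monomial ε s := by
  have hinv : CliffordAlgebra.involute (Q := (0 : QuadraticForm ℝ E)) (monomial ε s) =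
      (-1 : ℝ) ^ s.card • monomial ε s := by
    have := CliffordAlgebra.involute_prod_map_ι (Q := (0 : QuadraticForm ℝ E))
      ((s.sort (· ≤ ·)).map ε)
    rwa [List.map_map, List.length_map, Finset.length_sort] at this
  have hanti := interiorProduct_ι_mul (ε i) (ε i) (monomial ε s)
  rw [real_inner_self_eq_norm_sq, ε.norm_eq_one, one_pow, one_smul] at hanti
  have hsq : ι ℝ (ε i) * (ι ℝ (ε i) * monomial ε s) = 0 := by
    rw [← mul_assoc, ι_sq_zero, zero_mul]
  have hcc : interiorProduct (ε i) (interiorProduct (ε i) (monomial ε s)) = 0 :=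
    CliffordAlgebra.contractLeft_contractLeft _ _
  have hmain : (leftAction (ε i) * rightAction (ε i)) (monomial ε s) =
      (-1 : ℝ) ^ s.card • (ι ℝ (ε i) * interiorProduct (ε i) (monomial ε s) -
        interiorProduct (ε i) (ι ℝ (ε i) * monomial ε s)) := by
    simp only [Module.End.mul_apply, rightAction, LinearMap.comp_apply,
      AlgHom.toLinearMap_apply, hinv, map_smul, leftAction, LinearMap.add_apply,
      LinearMap.sub_apply, LinearMap.mulLeft_apply, map_add, hsq, hcc]
    congr 1
    abel
  rw [hmain, mul_smul]
  congr 1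
  by_cases hi : i ∈ s
  · have h0 : ι ℝ (ε i) * monomial ε s = 0 :=
      ι_mul_prod_eq_zero _ _ _ (by simpa using hi)
    rw [h0, map_zero] at hanti
    rw [h0, map_zero, sub_zero, if_pos hi, one_smul]
    exact (sub_eq_zero.1 hanti.symm).symm
  · have h0 : interiorProduct (ε i) (monomial ε s) = 0 := by
      refine interiorProduct_prod_eq_zero _ _ _ fun j hj => ε.orthonormal.2 ?_
      rintro rfl
      exact hi (by simpa using hj)
    rw [hanti, h0, if_neg hi]
    simp

end MonomialEigenvectors

lemma bilin_sum_smul_self {κ E : Type*} [Fintype κ] [DecidableEq κ] [AddCommGroup E]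
    [Module ℝ E] (B : LinearMap.BilinForm ℝ E) (m : κ → E)
    (hm : ∀ s t, B (m s) (m t) = if s = t then 1 else 0) (c : κ → ℝ) :
    B (∑ s, c s • m s) (∑ s, c s • m s) = ∑ s, c s ^ 2 := by
  simp [map_sum, LinearMap.sum_apply, hm, sq]

lemma abs_sum_mul_sign_le {n : ℕ} (μ : Fin n → ℝ) (hμ : ∀ i, 0 ≤ μ i) (s : Finset (Fin n)) :
    |∑ i, μ i * ((-1 : ℝ) ^ s.card * if i ∈ s then 1 else -1)| ≤ ∑ i, μ i := by
  refine (Finset.abs_sum_le_sum_abs _ _).trans (Finset.sum_le_sum fun i _ => ?_)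
  rw [abs_mul, abs_mul, abs_pow, abs_neg, abs_one, one_pow, one_mul, abs_of_nonneg (hμ i)]
  split_ifs <;> simp

/-- Let `(ε i)` be an orthonormal basis of `V`, let `μ i` be real
numbers with `0 < μ i ≤ 1`, and let `L = Σ_i μ_i ℓ(ε_i) r(ε_i)` as an endomorphism of
`Λ•V` with the induced inner product. Then the operator norm of `L` (for the induced
norm `ψ ↦ √⟨ψ, ψ⟩`) equals `Σ_i μ i`; in particular `‖L ψ‖ ≤ n ‖ψ‖` for every
`ψ : Λ•V`, and the operator norm of `L` equals `n` if and only if `μ i = 1` for all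
`i`. -/
theorem sum_leftAction_rightAction_opNorm
    (B : LinearMap.BilinForm ℝ (ExteriorAlgebra ℝ V)) (hB : IsInducedInner B)
    {n : ℕ} (ε : OrthonormalBasis (Fin n) ℝ V) (μ : Fin n → ℝ)
    (hμ : ∀ i, 0 < μ i ∧ μ i ≤ 1)
    (L : Module.End ℝ (ExteriorAlgebra ℝ V))
    (hL : L = ∑ i, μ i • (leftAction (ε i) * rightAction (ε i))) :
    IsLeast {c : ℝ | 0 ≤ c ∧ ∀ ψ,
        Real.sqrt (B (L ψ) (L ψ)) ≤ c * Real.sqrt (B ψ ψ)} (∑ i, μ i) ∧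
    (∀ ψ, Real.sqrt (B (L ψ) (L ψ)) ≤ (n : ℝ) * Real.sqrt (B ψ ψ)) ∧
    ((∑ i, μ i) = (n : ℝ) ↔ ∀ i, μ i = 1) := by
  obtain rfl : n = Module.finrank ℝ V := by
    simpa using (Module.finrank_eq_card_basis ε.toBasis).symm
  have hB' := hB.2 ε
  set d : Finset (Fin (Module.finrank ℝ V)) → ℝ := fun s =>
    ∑ i, μ i * ((-1 : ℝ) ^ s.card * if i ∈ s then 1 else -1) with hd
  have hLm : ∀ s, L (monomial ε s) = d s • monomial ε s := by
    intro s
    simp only [hL, hd, LinearMap.sum_apply, LinearMap.smul_apply,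
      leftAction_mul_rightAction_monomial, smul_smul, Finset.sum_smul]
  have hμ0 : 0 ≤ ∑ i, μ i := Finset.sum_nonneg fun i _ => (hμ i).1.le
  have hbound : ∀ ψ, Real.sqrt (B (L ψ) (L ψ)) ≤ (∑ i, μ i) * Real.sqrt (B ψ ψ) := by
    intro ψ
    have hψ : ψ ∈ Submodule.span ℝ (Set.range (monomial ε)) := by
      have := span_monomial_eq_top ε.toBasis
      rw [ε.coe_toBasis] at this
      rw [this]
      trivial
    obtain ⟨c, rfl⟩ := (Submodule.mem_span_range_iff_exists_fun ℝ).1 hψ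
    have hLψ : L (∑ s, c s • monomial ε s) = ∑ s, (c s * d s) • monomial ε s := by
      simp only [map_sum, map_smul, hLm, smul_smul]
    rw [hLψ, bilin_sum_smul_self B _ hB', bilin_sum_smul_self B _ hB']
    refine Real.sqrt_le_iff.2 ⟨by positivity, ?_⟩
    rw [mul_pow, Real.sq_sqrt (by positivity), Finset.mul_sum]
    refine Finset.sum_le_sum fun s _ => ?_
    have hds : d s ^ 2 ≤ (∑ i, μ i) ^ 2 :=
      sq_le_sq' (abs_le.1 (abs_sum_mul_sign_le μ (fun i => (hμ i).1.le) s)).1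
        (abs_le.1 (abs_sum_mul_sign_le μ (fun i => (hμ i).1.le) s)).2
    rw [mul_pow, mul_comm]
    exact mul_le_mul_of_nonneg_right hds (sq_nonneg _)
  have hμn : ∑ i, μ i ≤ (Module.finrank ℝ V : ℝ) := by
    simpa using Finset.sum_le_sum fun i (_ : i ∈ Finset.univ) => (hμ i).2
  refine ⟨⟨⟨hμ0, hbound⟩, ?_⟩, fun ψ => (hbound ψ).trans ?_, ?_⟩
  · rintro c ⟨-, hc⟩
    have h := hc (monomial ε ∅)
    have hd0 : d ∅ = -∑ i, μ i := by simp [hd]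
    rw [hLm, hd0] at h
    simpa [hB', Real.sqrt_mul_self hμ0] using h
  · exact mul_le_mul_of_nonneg_right hμn (Real.sqrt_nonneg _)
  · have h := Finset.sum_eq_sum_iff_of_le fun i (_ : i ∈ Finset.univ) => (hμ i).2
    simpa using h
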